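/- Let p, q, r be nonzero real numbers and fix n. If the map (A,B,C) ↦ Tr[A^{q/2} B^p A^{q/2} C^r] is jointly concave on triples of n×n positive definite complex matrices, then the operator-valued map (A,B) ↦ A^{q/2} B^p A^{q/2} is jointly operator concave on pairs of n×n positive definite complex matrices. -/

import Mathlib

open Matrix
open scoped ComplexOrder

/-- Real power of a matrix, defined via the spectral decomposition when the matrix is
Hermitian (junk value `0` otherwise). For a positive (semi-)definite matrix this is the
usual real power given by the spectral functional calculus (with `0 ^ r = 0`). -/
noncomputable def mpow {n : ℕ} (A : Matrix (Fin n) (Fin n) ℂ) (r : ℝ) :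
    Matrix (Fin n) (Fin n) ℂ :=
  if h : A.IsHermitian then
    (h.eigenvectorUnitary : Matrix (Fin n) (Fin n) ℂ) *
      Matrix.diagonal (fun i => ((h.eigenvalues i ^ r : ℝ) : ℂ)) *
      (star h.eigenvectorUnitary : Matrix (Fin n) (Fin n) ℂ)
  else 0

/-- `Tr[A^{q/2} B^p A^{q/2} C^r]` (as a real number). -/
noncomputable def trTriple {n : ℕ} (p q r : ℝ) (A B C : Matrix (Fin n) (Fin n) ℂ) : ℝ :=
  (Matrix.trace (mpow A (q / 2) * mpow B p * mpow A (q / 2) * mpow C r)).re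

/-- Joint convexity of a real-valued function of three positive definite matrices. -/
def JointlyConvex3 {n : ℕ}
    (f : Matrix (Fin n) (Fin n) ℂ → Matrix (Fin n) (Fin n) ℂ → Matrix (Fin n) (Fin n) ℂ → ℝ) :
    Prop :=
  ∀ A₁ A₂ B₁ B₂ C₁ C₂ : Matrix (Fin n) (Fin n) ℂ,
    A₁.PosDef → A₂.PosDef → B₁.PosDef → B₂.PosDef → C₁.PosDef → C₂.PosDef →
    ∀ t : ℝ, 0 ≤ t → t ≤ 1 →
      f (t • A₁ + (1 - t) • A₂) (t • B₁ + (1 - t) • B₂) (t • C₁ + (1 - t) • C₂) ≤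
        t * f A₁ B₁ C₁ + (1 - t) * f A₂ B₂ C₂

/-- Joint concavity of a real-valued function of three positive definite matrices. -/
def JointlyConcave3 {n : ℕ}
    (f : Matrix (Fin n) (Fin n) ℂ → Matrix (Fin n) (Fin n) ℂ → Matrix (Fin n) (Fin n) ℂ → ℝ) :
    Prop :=
  ∀ A₁ A₂ B₁ B₂ C₁ C₂ : Matrix (Fin n) (Fin n) ℂ,
    A₁.PosDef → A₂.PosDef → B₁.PosDef → B₂.PosDef → C₁.PosDef → C₂.PosDef →
    ∀ t : ℝ, 0 ≤ t → t ≤ 1 →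
      t * f A₁ B₁ C₁ + (1 - t) * f A₂ B₂ C₂ ≤
        f (t • A₁ + (1 - t) • A₂) (t • B₁ + (1 - t) • B₂) (t • C₁ + (1 - t) • C₂)

/-- Joint operator concavity (in the Loewner order) of a matrix-valued function of two
positive definite matrices. -/
def JointlyOpConcave {n : ℕ}
    (F : Matrix (Fin n) (Fin n) ℂ → Matrix (Fin n) (Fin n) ℂ → Matrix (Fin n) (Fin n) ℂ) :
    Prop :=
  ∀ A₁ A₂ B₁ B₂ : Matrix (Fin n) (Fin n) ℂ,
    A₁.PosDef → A₂.PosDef → B₁.PosDef → B₂.PosDef →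
    ∀ t : ℝ, 0 ≤ t → t ≤ 1 →
      (F (t • A₁ + (1 - t) • A₂) (t • B₁ + (1 - t) • B₂) -
        (t • F A₁ B₁ + (1 - t) • F A₂ B₂)).PosSemidef

theorem mpow_eq_cfc {n : ℕ} {A : Matrix (Fin n) (Fin n) ℂ} (hA : A.IsHermitian) (r : ℝ) :
    mpow A r = cfc (fun x : ℝ => x ^ r) A := by
  rw [hA.cfc_eq, mpow, dif_pos hA, IsHermitian.cfc, Unitary.conjStarAlgAut_apply]
  rfl

theorem isHermitian_mpow {n : ℕ} (A : Matrix (Fin n) (Fin n) ℂ) (r : ℝ) :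
    (mpow A r).IsHermitian := by
  by_cases hA : A.IsHermitian
  · rw [mpow_eq_cfc hA]
    exact cfc_predicate (p := IsSelfAdjoint) _ A
  · rw [mpow, dif_neg hA]
    exact isHermitian_zero

theorem isHermitian_mpow_mul_mpow_mul_mpow {n : ℕ} (A B : Matrix (Fin n) (Fin n) ℂ) (p q : ℝ) :
    (mpow A q * mpow B p * mpow A q).IsHermitian := by
  have h := isHermitian_mul_mul_conjTranspose (mpow A q) (isHermitian_mpow B p)
  rwa [(isHermitian_mpow A q).eq] at h

open scoped MatrixOrder in
/-- For `r ≠ 0`, every positive definite matrix is an `r`-th power of a positive definite one. -/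
theorem Matrix.PosDef.exists_mpow_eq {n : ℕ} {D : Matrix (Fin n) (Fin n) ℂ} (hD : D.PosDef)
    {r : ℝ} (hr : r ≠ 0) : ∃ C : Matrix (Fin n) (Fin n) ℂ, C.PosDef ∧ mpow C r = D := by
  have hspec : ∀ x ∈ spectrum ℝ D, 0 < x := by
    intro x hx
    rw [hD.1.spectrum_real_eq_range_eigenvalues] at hx
    obtain ⟨i, rfl⟩ := hx
    exact hD.eigenvalues_pos i
  have hself : IsSelfAdjoint D := hD.1
  have hcont : ContinuousOn (fun x : ℝ => x ^ r⁻¹) (spectrum ℝ D) := fun x hx =>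
    (Real.continuousAt_rpow_const x _ (Or.inl (hspec x hx).ne')).continuousWithinAt
  have hC : (cfc (fun x : ℝ => x ^ r⁻¹) D).PosDef := by
    rw [← isStrictlyPositive_iff_posDef, cfc_isStrictlyPositive_iff _ _ hcont hself]
    exact fun x hx => Real.rpow_pos_of_pos (hspec x hx) _
  refine ⟨_, hC, ?_⟩
  rw [mpow_eq_cfc hC.1, ← cfc_comp' (fun x : ℝ => x ^ r) (fun x : ℝ => x ^ r⁻¹) D ?_ hcont hself]
  · conv_rhs => rw [← cfc_id' ℝ D hself]
    exact cfc_congr fun x hx => Real.rpow_inv_rpow (hspec x hx).le hr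
  · rintro _ ⟨x, hx, rfl⟩
    exact (Real.continuousAt_rpow_const _ _
      (Or.inl (Real.rpow_pos_of_pos (hspec x hx) _).ne')).continuousWithinAt

/-- A Hermitian matrix pairing nonnegatively with all positive definite matrices is positive
semidefinite. -/
theorem Matrix.IsHermitian.posSemidef_of_trace_mul_nonneg {n : ℕ}
    {H : Matrix (Fin n) (Fin n) ℂ} (hH : H.IsHermitian)
    (h : ∀ D : Matrix (Fin n) (Fin n) ℂ, D.PosDef → 0 ≤ (trace (H * D)).re) :
    H.PosSemidef := by
  refine .of_dotProduct_mulVec_nonneg hH fun v => ?_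
  have him : (star v ⬝ᵥ (H *ᵥ v)).im = 0 := hH.im_star_dotProduct_mulVec_self v
  refine Complex.nonneg_iff.mpr ⟨?_, him.symm⟩
  have hε : ∀ ε : ℝ, 0 < ε → 0 ≤ ε * (trace H).re + (star v ⬝ᵥ (H *ᵥ v)).re := by
    intro ε hε
    have hD : (ε • (1 : Matrix (Fin n) (Fin n) ℂ) + vecMulVec v (star v)).PosDef :=
      (PosDef.one.smul hε).add_posSemidef (posSemidef_vecMulVec_self_star v)
    have := h _ hD
    rwa [mul_add, mul_smul_comm, mul_one, mul_vecMulVec, trace_add, trace_smul, trace_vecMulVec,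
      dotProduct_comm, Complex.add_re, Complex.smul_re, smul_eq_mul] at this
  have hlim : Filter.Tendsto (fun ε : ℝ => ε * (trace H).re + (star v ⬝ᵥ (H *ᵥ v)).re)
      (nhdsWithin 0 (Set.Ioi 0)) (nhds (0 * (trace H).re + (star v ⬝ᵥ (H *ᵥ v)).re)) :=
    (Continuous.tendsto (by fun_prop) 0).mono_left nhdsWithin_le_nhds
  rw [zero_mul, zero_add] at hlim
  exact ge_of_tendsto hlim (Filter.eventually_of_mem self_mem_nhdsWithin hε)

/-- Lemma 3.1, concave case: trace concavity of `(A,B,C) ↦ Tr[A^{q/2} B^p A^{q/2} C^r]`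
implies joint operator concavity of `(A,B) ↦ A^{q/2} B^p A^{q/2}`. -/
theorem trace_concave_implies_operator_concave (p q r : ℝ) (hp : p ≠ 0) (hq : q ≠ 0)
    (hr : r ≠ 0) (n : ℕ) (hconc : JointlyConcave3 (trTriple (n := n) p q r)) :
    JointlyOpConcave (fun A B : Matrix (Fin n) (Fin n) ℂ =>
      mpow A (q / 2) * mpow B p * mpow A (q / 2)) := by
  intro A₁ A₂ B₁ B₂ hA₁ hA₂ hB₁ hB₂ t ht₀ ht₁
  have hF := fun A B : Matrix (Fin n) (Fin n) ℂ =>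
    isHermitian_mpow_mul_mpow_mul_mpow A B p (q / 2)
  refine IsHermitian.posSemidef_of_trace_mul_nonneg
    ((hF _ _).sub (((hF _ _).smul (IsSelfAdjoint.all t)).add
      ((hF _ _).smul (IsSelfAdjoint.all (1 - t))))) fun D hD => ?_
  obtain ⟨C, hC, rfl⟩ := hD.exists_mpow_eq hr
  have h := hconc A₁ A₂ B₁ B₂ C C hA₁ hA₂ hB₁ hB₂ hC hC t ht₀ ht₁
  rw [← add_smul, add_sub_cancel, one_smul] at h
  simp only [trTriple] at h
  rw [sub_mul, add_mul, smul_mul_assoc, smul_mul_assoc, trace_sub, trace_add, trace_smul,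
    trace_smul, Complex.sub_re, Complex.add_re, Complex.smul_re, Complex.smul_re]
  simpa only [smul_eq_mul, sub_nonneg] using h
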